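/- Let f ∈ Diff¹_ω(D) and let (g_k) be a sequence in Diff¹_ω(D) such that each g_k has finite order (g_k^{p_k} = id for some p_k ≥ 1) and d₁(g_k, f) → 0 as k → ∞. Then Cal₁(f) = 0. -/

import Mathlib

open MeasureTheory Metric Set Filter Topology
open scoped Real

noncomputable section

/-- The closed unit disk in `ℂ ≅ ℝ²`. -/
def Disk : Set ℂ := Metric.closedBall 0 1

/-- The unit circle, boundary of the closed unit disk. -/
def Circ : Set ℂ := Metric.sphere 0 1

/-- The standard Liouville form `λ_z(w) = (z₁ w₂ - z₂ w₁)/(2π)`, whose exterior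
derivative is the normalized area form `ω = (1/π) du ∧ dv`. -/
def lform (z w : ℂ) : ℝ := (z.re * w.im - z.im * w.re) / (2 * Real.pi)

/-- An element of `Diff¹_ω(D)`: a `C¹` diffeomorphism of the closed unit disk onto itself
whose Jacobian determinant equals `1` at every point. -/
structure SympDiff where
  toFun : ℂ → ℂ
  invFun : ℂ → ℂ
  mapsTo : Set.MapsTo toFun Disk Disk
  inv_mapsTo : Set.MapsTo invFun Disk Disk
  left_inv : ∀ z ∈ Disk, invFun (toFun z) = z
  right_inv : ∀ z ∈ Disk, toFun (invFun z) = z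
  contDiffOn : ContDiffOn ℝ 1 toFun Disk
  inv_contDiffOn : ContDiffOn ℝ 1 invFun Disk
  jacobian : ∀ z ∈ Disk,
    LinearMap.det (fderivWithin ℝ toFun Disk z).toLinearMap = 1

/-- `A` is an action function of `f`: a `C¹` function with `dA = f*λ - λ` on the disk. -/
def IsAction (f : SympDiff) (A : ℂ → ℝ) : Prop :=
  ContDiffOn ℝ 1 A Disk ∧
    ∀ z ∈ Disk, ∀ w : ℂ,
      fderivWithin ℝ A Disk z w =
        lform (f.toFun z) (fderivWithin ℝ f.toFun Disk z w) - lform z w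

/-- `μ` is a Borel probability measure concentrated on the unit circle and invariant
under `f|_{S¹}`. -/
def IsInvariantCircleMeasure (f : SympDiff) (μ : Measure ℂ) : Prop :=
  IsProbabilityMeasure μ ∧ μ Circᶜ = 0 ∧ Measure.map f.toFun μ = μ

/-- `A` is a normalized action function of `f`: an action function whose integral over the
circle with respect to some `f|_{S¹}`-invariant probability measure vanishes. -/
def IsNormalizedAction (f : SympDiff) (A : ℂ → ℝ) : Prop :=
  IsAction f A ∧
    ∃ μ : Measure ℂ, IsInvariantCircleMeasure f μ ∧ ∫ z, A z ∂μ = 0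

/-- The `C⁰` distance between two disk diffeomorphisms (given with their inverses). -/
def d0 (f fi g gi : ℂ → ℂ) : ℝ :=
  max (⨆ z : Disk, ‖f (z : ℂ) - g (z : ℂ)‖) (⨆ z : Disk, ‖fi (z : ℂ) - gi (z : ℂ)‖)

/-- The `C¹` distance between two disk diffeomorphisms (given with their inverses). -/
def d1 (f fi g gi : ℂ → ℂ) : ℝ :=
  max (d0 f fi g gi)
    (max (⨆ z : Disk, ‖fderivWithin ℝ f Disk (z : ℂ) - fderivWithin ℝ g Disk (z : ℂ)‖)
      (⨆ z : Disk, ‖fderivWithin ℝ fi Disk (z : ℂ) - fderivWithin ℝ gi Disk (z : ℂ)‖))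

/-- The Liouville form at `z` as a continuous linear map. -/
def liouvilleCLM (z : ℂ) : ℂ →L[ℝ] ℝ :=
  (2 * Real.pi)⁻¹ • (z.re • Complex.imCLM - z.im • Complex.reCLM)

lemma liouvilleCLM_apply (z w : ℂ) : liouvilleCLM z w = lform z w := by
  simp [liouvilleCLM, lform, div_eq_inv_mul]

/-- `B` is a primitive of `F*λ - λ` on the closed disk. -/
def IsPrimitive (F : ℂ → ℂ) (B : ℂ → ℝ) : Prop :=
  ∀ z ∈ Disk, ∃ F' : ℂ →L[ℝ] ℂ, HasFDerivWithinAt F F' Disk z ∧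
    HasFDerivWithinAt B ((liouvilleCLM (F z)).comp F' - liouvilleCLM z) Disk z

lemma IsPrimitive.continuousOn {F : ℂ → ℂ} {B : ℂ → ℝ} (h : IsPrimitive F B) :
    ContinuousOn B Disk := fun z hz => by
  obtain ⟨_, _, h2⟩ := h z hz
  exact h2.continuousWithinAt

lemma isPrimitive_id : IsPrimitive id 0 := fun z _ =>
  ⟨ContinuousLinearMap.id ℝ ℂ, hasFDerivWithinAt_id _ _, by
    refine (hasFDerivWithinAt_const (0 : ℝ) z Disk).congr_fderiv ?_
    ext w
    simp⟩

lemma IsPrimitive.comp {F f : ℂ → ℂ} {B A : ℂ → ℝ} (hf : IsPrimitive f A) (hF : IsPrimitive F B)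
    (hm : MapsTo F Disk Disk) : IsPrimitive (f ∘ F) (fun z => B z + A (F z)) := by
  intro z hz
  obtain ⟨F', hF', hB⟩ := hF z hz
  obtain ⟨f', hf', hA⟩ := hf (F z) (hm hz)
  refine ⟨f'.comp F', hf'.comp z hF' hm, ?_⟩
  refine (hB.add (hA.comp z hF' hm)).congr_fderiv ?_
  ext w
  simp

lemma IsPrimitive.birkhoff {f : ℂ → ℂ} {A : ℂ → ℝ} (hf : IsPrimitive f A)
    (hm : MapsTo f Disk Disk) (n : ℕ) : IsPrimitive f^[n] (birkhoffSum f A n) := by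
  induction n with
  | zero => simpa [birkhoffSum_zero'] using isPrimitive_id
  | succ n ih =>
    rw [Function.iterate_succ']
    rw [show birkhoffSum f A (n + 1) = fun z => birkhoffSum f A n z + A (f^[n] z) from
      funext fun z => birkhoffSum_succ f A n z]
    exact hf.comp ih (hm.iterate n)

lemma uniqueDiffOn_disk : UniqueDiffOn ℝ Disk :=
  uniqueDiffOn_convex (convex_closedBall 0 1)
    ⟨0, by rw [Disk, interior_closedBall _ one_ne_zero]; simp⟩

/-- Primitives of `F*λ - λ` differ by a constant. -/
lemma IsPrimitive.sub_eq_sub {F : ℂ → ℂ} {A B : ℂ → ℝ} (hA : IsPrimitive F A)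
    (hB : IsPrimitive F B) {x y : ℂ} (hx : x ∈ Disk) (hy : y ∈ Disk) : A x - B x = A y - B y := by
  have key : ∀ z ∈ Disk, HasFDerivWithinAt (fun z => A z - B z) (0 : ℂ →L[ℝ] ℝ) Disk z := by
    intro z hz
    obtain ⟨F', hF', hA'⟩ := hA z hz
    obtain ⟨G', hG', hB'⟩ := hB z hz
    obtain rfl := (uniqueDiffOn_disk z hz).eq hF' hG'
    simpa using hA'.fun_sub hB'
  have hd : DifferentiableOn ℝ (fun z => A z - B z) Disk := fun z hz =>
    (key z hz).differentiableWithinAt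
  have h0 : ∀ z ∈ Disk, fderivWithin ℝ (fun z => A z - B z) Disk z = 0 := fun z hz =>
    (key z hz).fderivWithin (uniqueDiffOn_disk z hz)
  exact (convex_closedBall (0 : ℂ) 1).is_const_of_fderivWithin_eq_zero hd h0 hx hy

/-- A primitive for a map which is the identity on the disk is constant. -/
lemma IsPrimitive.eq_of_eq_id {F : ℂ → ℂ} {B : ℂ → ℝ} (h : IsPrimitive F B)
    (hid : ∀ z ∈ Disk, F z = z) {x y : ℂ} (hx : x ∈ Disk) (hy : y ∈ Disk) : B x = B y := by
  have h0 : IsPrimitive F 0 := fun z hz => by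
    obtain ⟨F', hF', hB⟩ := isPrimitive_id z hz
    refine ⟨F', hF'.congr hid (hid z hz), ?_⟩
    rwa [hid z hz]
  simpa using h.sub_eq_sub h0 hx hy

lemma circ_subset_disk : Circ ⊆ Disk := sphere_subset_closedBall

lemma exp_mul_I_mem_circ (t : ℝ) : Complex.exp (t * Complex.I) ∈ Circ := by
  simp [Circ, Complex.norm_exp_ofReal_mul_I]

lemma IsPrimitive.hasDerivAt_circle {F : ℂ → ℂ} {B : ℂ → ℝ} (h : IsPrimitive F B)
    (hm : MapsTo F Circ Circ) (t : ℝ) :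
    ∃ b : ℝ, HasDerivAt (fun s : ℝ => B (Complex.exp (s * Complex.I))) b t ∧
      HasDerivAt (fun s : ℝ => F (Complex.exp (s * Complex.I)))
        ((2 * π * b + 1 : ℝ) * Complex.I * F (Complex.exp (t * Complex.I))) t := by
  have he : HasDerivAt (fun s : ℝ => Complex.exp (s * Complex.I))
      (Complex.exp (t * Complex.I) * Complex.I) t := by
    have := ((Complex.ofRealCLM.hasDerivAt (x := t)).mul_const Complex.I).cexp
    simpa using this
  have hmem (s : ℝ) : Complex.exp (s * Complex.I) ∈ Disk :=
    circ_subset_disk (exp_mul_I_mem_circ s)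
  obtain ⟨F', hF', hB⟩ := h _ (hmem t)
  have hG := hF'.comp_hasDerivAt t he (Eventually.of_forall hmem)
  refine ⟨_, hB.comp_hasDerivAt t he (Eventually.of_forall hmem), ?_⟩
  refine hG.congr_deriv ?_
  set v := F' (Complex.exp (t * Complex.I) * Complex.I)
  set u := F (Complex.exp (t * Complex.I)) with hu
  have hnorm : ∀ s : ℝ, Complex.normSq (F (Complex.exp (s * Complex.I))) = 1 := by
    intro s
    have := hm (exp_mul_I_mem_circ s)
    simp only [Circ, mem_sphere_iff_norm, sub_zero] at this
    rw [Complex.normSq_eq_norm_sq, this]; norm_num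
  have hre := Complex.reCLM.hasFDerivAt.comp_hasDerivAt t hG
  have him := Complex.imCLM.hasFDerivAt.comp_hasDerivAt t hG
  have horth : u.re * v.re + u.im * v.im = 0 := by
    have h1 := (hre.mul hre).add (him.mul him)
    have h2 : HasDerivAt (fun _ : ℝ => (1 : ℝ)) 0 t := hasDerivAt_const t 1
    have := h1.unique (h2.congr_of_eventuallyEq (Eventually.of_forall fun s => by
      have := hnorm s
      rw [Complex.normSq_apply] at this
      simpa using this))
    simp only [Function.comp, Complex.reCLM_apply, Complex.imCLM_apply] at this
    change v.re * u.re + u.re * v.re + (v.im * u.im + u.im * v.im) = 0 at this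
    linarith
  have hone : u.re * u.re + u.im * u.im = 1 := by
    have := hnorm t
    rwa [Complex.normSq_apply] at this
  have hb : 2 * π * (((liouvilleCLM u).comp F' - liouvilleCLM (Complex.exp (t * Complex.I)))
      (Complex.exp (t * Complex.I) * Complex.I)) + 1 = u.re * v.im - u.im * v.re := by
    have h1 : (Complex.exp (t * Complex.I)).re * (Complex.exp (t * Complex.I)).re +
        (Complex.exp (t * Complex.I)).im * (Complex.exp (t * Complex.I)).im = 1 := by
      rw [← Complex.normSq_apply, Complex.normSq_eq_norm_sq, Complex.norm_exp_ofReal_mul_I]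
      norm_num
    rw [_root_.sub_apply, ContinuousLinearMap.comp_apply, liouvilleCLM_apply,
      liouvilleCLM_apply]
    change 2 * π * (lform u v - lform _ _) + 1 = _
    have hpi := Real.pi_ne_zero
    unfold lform
    field_simp
    simp only [Complex.mul_re, Complex.mul_im, Complex.I_re, Complex.I_im]
    linarith
  rw [hb]
  change v = _
  apply Complex.ext
  · simp
    linear_combination -v.re * hone + u.re * horth
  · simp
    linear_combination -v.im * hone + u.im * horth

/-- The oscillation along the circle of a primitive of `F*λ - λ` is at most `2`. -/
lemma IsPrimitive.abs_sub_le {F : ℂ → ℂ} {B : ℂ → ℝ} (h : IsPrimitive F B)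
    (hm : MapsTo F Circ Circ) (hinj : InjOn F Circ) {x y : ℂ} (hx : x ∈ Circ) (hy : y ∈ Circ) :
    |B x - B y| ≤ 2 := by
  choose b hb hG using h.hasDerivAt_circle hm
  set e : ℝ → ℂ := fun t => Complex.exp (t * Complex.I)
  set θ : ℝ → ℝ := fun t => 2 * π * B (e t) + t
  have hθ (t : ℝ) : HasDerivAt θ (2 * π * b t + 1) t := ((hb t).const_mul _).add (hasDerivAt_id t)
  have hlift : ∀ s t : ℝ, F (e s) * Complex.exp (-(θ s * Complex.I)) =
      F (e t) * Complex.exp (-(θ t * Complex.I)) := by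
    have hd (t : ℝ) : HasDerivAt (fun s => F (e s) * Complex.exp (-(θ s * Complex.I))) 0 t := by
      have := (hG t).mul ((hθ t).ofReal_comp.mul_const Complex.I).neg.cexp
      refine this.congr_deriv ?_
      push_cast
      ring
    exact is_const_of_deriv_eq_zero (fun t => (hd t).differentiableAt) fun t => (hd t).deriv
  have hθc : Continuous θ := continuous_iff_continuousAt.2 fun t => (hθ t).continuousAt
  have hne : ∀ a c : ℝ, a ≤ c → c < a + 2 * π → ∀ m : ℤ, θ c = θ a + m * (2 * π) → m = 0 := by
    intro a c hac hca m hm'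
    have hF : F (e c) = F (e a) := by
      have h1 := hlift c a
      have h2 : Complex.exp (-(θ c * Complex.I)) = Complex.exp (-(θ a * Complex.I)) := by
        rw [Complex.exp_eq_exp_iff_exists_int]
        refine ⟨-m, ?_⟩
        rw [hm']; push_cast; ring
      rw [h2] at h1
      exact mul_right_cancel₀ (Complex.exp_ne_zero _) h1
    have he : e c = e a := hinj (exp_mul_I_mem_circ c) (exp_mul_I_mem_circ a) hF
    obtain ⟨n, hn⟩ := Complex.exp_eq_exp_iff_exists_int.1 he
    have hn' : c = a + n * (2 * π) := by
      have := congrArg Complex.im hn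
      simpa using this
    have hpi := Real.pi_pos
    have hn0 : n = 0 := by
      have h1 : (-1 : ℝ) < n := by nlinarith
      have h2 : (n : ℝ) < 1 := by nlinarith
      have h3 : -1 < n := by exact_mod_cast h1
      have h4 : n < 1 := by exact_mod_cast h2
      omega
    have hca' : c = a := by simpa [hn0] using hn'
    rw [hca'] at hm'
    have : (m : ℝ) * (2 * π) = 0 := by linarith
    have : (m : ℝ) = 0 := by
      rcases mul_eq_zero.1 this with h | h
      · exact h
      · linarith
    exact_mod_cast this
  have hosc : ∀ a c : ℝ, a ≤ c → c < a + 2 * π → |B (e a) - B (e c)| ≤ 2 := by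
    intro a c hac hca
    have hpi := Real.pi_pos
    have hivt := intermediate_value_uIcc (a := a) (b := c) hθc.continuousOn
    rw [uIcc_of_le hac] at hivt
    have h1 : θ c - θ a ≤ 2 * π := by
      by_contra! hlt
      obtain ⟨d, hd, hd'⟩ := hivt (show θ a + 2 * π ∈ uIcc (θ a) (θ c) by
        rw [uIcc_of_le (by linarith)]; constructor <;> linarith)
      have := hne a d hd.1 (by linarith [hd.2]) 1 (by rw [hd']; push_cast; ring)
      omega
    have h2 : -(2 * π) ≤ θ c - θ a := by
      by_contra! hlt
      obtain ⟨d, hd, hd'⟩ := hivt (show θ a - 2 * π ∈ uIcc (θ a) (θ c) by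
        rw [uIcc_of_ge (by linarith)]; constructor <;> linarith)
      have := hne a d hd.1 (by linarith [hd.2]) (-1) (by rw [hd']; push_cast; ring)
      omega
    have hθa : θ a = 2 * π * B (e a) + a := rfl
    have hθc' : θ c = 2 * π * B (e c) + c := rfl
    rw [abs_le]
    constructor <;> nlinarith
  have harg : ∀ z ∈ Circ, e z.arg = z := by
    intro z hz
    have hz' : ‖z‖ = 1 := by simpa [Circ] using hz
    have := Complex.norm_mul_exp_arg_mul_I z
    rwa [hz', Complex.ofReal_one, one_mul] at this
  have hlt (z w : ℂ) : z.arg < w.arg + 2 * π := by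
    linarith [Complex.arg_le_pi z, Complex.neg_pi_lt_arg w]
  rcases le_total x.arg y.arg with hle | hle
  · have := hosc _ _ hle (hlt _ _)
    rwa [harg x hx, harg y hy] at this
  · have := hosc _ _ hle (hlt _ _)
    rwa [harg x hx, harg y hy, abs_sub_comm] at this

namespace SympDiff

variable (f : SympDiff)

lemma hasFDerivWithinAt {z : ℂ} (hz : z ∈ Disk) :
    HasFDerivWithinAt f.toFun (fderivWithin ℝ f.toFun Disk z) Disk z :=
  (f.contDiffOn.differentiableOn one_ne_zero z hz).hasFDerivWithinAt

lemma inv_hasFDerivWithinAt {z : ℂ} (hz : z ∈ Disk) :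
    HasFDerivWithinAt f.invFun (fderivWithin ℝ f.invFun Disk z) Disk z :=
  (f.inv_contDiffOn.differentiableOn one_ne_zero z hz).hasFDerivWithinAt

lemma injOn : InjOn f.toFun Disk := fun x hx y hy hxy => by
  rw [← f.left_inv x hx, ← f.left_inv y hy, hxy]

lemma image_disk : f.toFun '' Disk = Disk :=
  Subset.antisymm f.mapsTo.image_subset fun z hz => ⟨f.invFun z, f.inv_mapsTo hz, f.right_inv z hz⟩

lemma integral_comp (A : ℂ → ℝ) : ∫ z in Disk, A (f.toFun z) = ∫ z in Disk, A z := by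
  have h := integral_image_eq_integral_abs_det_fderiv_smul volume
    (measurableSet_closedBall (x := (0 : ℂ)) (ε := 1))
    (fun z hz => f.hasFDerivWithinAt hz) f.injOn A
  change ∫ x in f.toFun '' Disk, A x = ∫ z in Disk, _ at h
  rw [f.image_disk] at h
  rw [h]
  refine setIntegral_congr_fun measurableSet_closedBall fun z hz => ?_
  have hdet : (fderivWithin ℝ f.toFun Disk z).det = 1 := f.jacobian z hz
  simp [hdet]

end SympDiff

/-- A `C¹` self-map of the disk maps interior points with surjective derivative to interior
points. -/
lemma mem_ball_of_surjective {h : ℂ → ℂ} (hm : MapsTo h Disk Disk) (hc : ContDiffOn ℝ 1 h Disk)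
    {z : ℂ} (hz : z ∈ ball (0 : ℂ) 1)
    (hs : Function.Surjective (fderivWithin ℝ h Disk z)) : h z ∈ ball (0 : ℂ) 1 := by
  have hn : Disk ∈ 𝓝 z := mem_of_superset (isOpen_ball.mem_nhds hz) ball_subset_closedBall
  have hst := (hc.contDiffAt hn).hasStrictFDerivAt one_ne_zero
  rw [fderivWithin_of_mem_nhds hn] at hs
  have hmap := hst.map_nhds_eq_of_surj (LinearMap.range_eq_top.2 hs)
  have : Disk ∈ 𝓝 (h z) := by
    rw [← hmap]
    exact mem_map.2 (mem_of_superset hn hm)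
  rwa [← mem_interior_iff_mem_nhds, Disk, interior_closedBall _ one_ne_zero] at this

namespace SympDiff

variable (f : SympDiff)

lemma mapsTo_circ : MapsTo f.toFun Circ Circ := by
  intro z hz
  have hzD : z ∈ Disk := circ_subset_disk hz
  have hfz : f.toFun z ∈ Disk := f.mapsTo hzD
  by_contra hcon
  have hb : f.toFun z ∈ ball (0 : ℂ) 1 := by
    simp only [Disk, Circ, mem_closedBall, mem_sphere, mem_ball] at *
    exact lt_of_le_of_ne hfz hcon
  have hcomp : (fderivWithin ℝ f.invFun Disk (f.toFun z)).comp (fderivWithin ℝ f.toFun Disk z) =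
      ContinuousLinearMap.id ℝ ℂ :=
    (uniqueDiffOn_disk z hzD).eq
      ((f.inv_hasFDerivWithinAt hfz).comp z (f.hasFDerivWithinAt hzD) f.mapsTo)
      ((hasFDerivWithinAt_id z Disk).congr f.left_inv (f.left_inv z hzD))
  have hs : Function.Surjective (fderivWithin ℝ f.invFun Disk (f.toFun z)) := fun w =>
    ⟨fderivWithin ℝ f.toFun Disk z w, DFunLike.congr_fun hcomp w⟩
  have := mem_ball_of_surjective f.inv_mapsTo f.inv_contDiffOn hb hs
  rw [f.left_inv z hzD] at this
  simp only [Circ, mem_sphere, mem_ball] at this hz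
  linarith

lemma injOn_iterate (n : ℕ) : InjOn f.toFun^[n] Disk := f.injOn.iterate f.mapsTo n

lemma isPrimitive_of_isAction {A : ℂ → ℝ} (hA : IsAction f A) : IsPrimitive f.toFun A := by
  intro z hz
  refine ⟨_, f.hasFDerivWithinAt hz, ?_⟩
  refine (hA.1.differentiableOn one_ne_zero z hz).hasFDerivWithinAt.congr_fderiv ?_
  ext w : 1
  rw [hA.2 z hz w]
  simp [liouvilleCLM_apply]

lemma continuousOn_iterate (n : ℕ) : ContinuousOn f.toFun^[n] Disk := by
  induction n with
  | zero => exact continuousOn_id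
  | succ n ih =>
    rw [Function.iterate_succ']
    exact f.contDiffOn.continuousOn.comp ih (f.mapsTo.iterate n)

lemma abs_birkhoffSum_sub_le {A : ℂ → ℝ} (hA : IsPrimitive f.toFun A) (n : ℕ) {x y : ℂ}
    (hx : x ∈ Circ) (hy : y ∈ Circ) :
    |birkhoffSum f.toFun A n x - birkhoffSum f.toFun A n y| ≤ 2 :=
  (hA.birkhoff f.mapsTo n).abs_sub_le (f.mapsTo_circ.iterate n)
    ((f.injOn_iterate n).mono circ_subset_disk) hx hy

/-- Birkhoff sums of a normalized action are bounded by `2` on the circle. -/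
lemma abs_birkhoffSum_le_of_isNormalizedAction {A : ℂ → ℝ} (hA : IsNormalizedAction f A) (n : ℕ)
    {x : ℂ} (hx : x ∈ Circ) : |birkhoffSum f.toFun A n x| ≤ 2 := by
  obtain ⟨hact, μ, ⟨hμ, hcirc, hmap⟩, hint⟩ := hA
  have hP := f.isPrimitive_of_isAction hact
  have hae : ∀ᵐ z ∂μ, z ∈ Circ := mem_ae_iff.2 hcirc
  have hres : μ.restrict Circ = μ := Measure.restrict_eq_self_of_ae_mem hae
  have hmC : MeasurableSet Circ := isClosed_sphere.measurableSet
  have hmeas {E : Type} [TopologicalSpace E] [MeasurableSpace E] [BorelSpace E]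
      [TopologicalSpace.PseudoMetrizableSpace E] (h : ℂ → E) (hc : ContinuousOn h Disk) :
      AEMeasurable h μ := by
    have := (hc.mono circ_subset_disk).aemeasurable (μ := μ) hmC
    rwa [hres] at this
  have hf := hmeas f.toFun f.contDiffOn.continuousOn
  have hmp (j : ℕ) : AEMeasurable f.toFun^[j] μ ∧ Measure.map f.toFun^[j] μ = μ := by
    induction j with
    | zero => exact ⟨aemeasurable_id, Measure.map_id⟩
    | succ j ih =>
      rw [Function.iterate_succ']
      refine ⟨hmeas _ ?_, ?_⟩
      · rw [← Function.iterate_succ']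
        exact f.continuousOn_iterate _
      · rw [← AEMeasurable.map_map_of_aemeasurable (by rwa [ih.2]) ih.1, ih.2, hmap]
  have hintble (h : ℂ → ℝ) (hc : ContinuousOn h Disk) : Integrable h μ := by
    have := (hc.mono circ_subset_disk).integrableOn_compact (μ := μ) (isCompact_sphere 0 1)
    rwa [IntegrableOn, ← Circ, hres] at this
  have hAj (j : ℕ) : ContinuousOn (fun z => A (f.toFun^[j] z)) Disk :=
    hP.continuousOn.comp (f.continuousOn_iterate j) (f.mapsTo.iterate j)
  have hzero : ∫ z, birkhoffSum f.toFun A n z ∂μ = 0 := by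
    simp only [birkhoffSum]
    rw [integral_finsetSum _ fun j _ => hintble _ (hAj j)]
    refine Finset.sum_eq_zero fun j _ => ?_
    have := integral_map (hmp j).1 (f := A)
      (by rw [(hmp j).2]; exact (hintble A hP.continuousOn).aestronglyMeasurable)
    rw [← this, (hmp j).2, hint]
  have hS := hintble _ (hP.birkhoff f.mapsTo n).continuousOn
  have h1 : ∫ z, (birkhoffSum f.toFun A n x - birkhoffSum f.toFun A n z) ∂μ =
      birkhoffSum f.toFun A n x := by
    rw [integral_sub (integrable_const _) hS, hzero]
    simp
  rw [← h1, ← Real.norm_eq_abs]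
  have := norm_integral_le_of_norm_le_const (μ := μ)
    (f := fun z => birkhoffSum f.toFun A n x - birkhoffSum f.toFun A n z) (C := 2)
    (hae.mono fun z hz => f.abs_birkhoffSum_sub_le hP n hx hz)
  simpa using this

lemma integral_iterate {A : ℂ → ℝ} (j : ℕ) :
    ∫ z in Disk, A (f.toFun^[j] z) = ∫ z in Disk, A z := by
  induction j with
  | zero => rfl
  | succ j ih =>
    simp only [Function.iterate_succ, Function.comp]
    rw [f.integral_comp (fun z => A (f.toFun^[j] z)), ih]

/-- For a map of finite order, Birkhoff sums of an action along the circle stay close to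
multiples of the mean of the action on the disk. -/
lemma abs_birkhoffSum_sub_mean_le {A : ℂ → ℝ} (hA : IsPrimitive f.toFun A) {p : ℕ} (hp : 1 ≤ p)
    (hper : ∀ z ∈ Disk, f.toFun^[p] z = z) (n : ℕ) {x : ℂ} (hx : x ∈ Circ) :
    |birkhoffSum f.toFun A n x - n * ((1 / π) * ∫ z in Disk, A z)| ≤ 2 := by
  set c := (1 / π) * ∫ z in Disk, A z with hc
  have hp0 : (0 : ℝ) < p := by exact_mod_cast hp
  have hconst : ∀ z ∈ Disk, birkhoffSum f.toFun A p z = birkhoffSum f.toFun A p x := fun z hz =>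
    (hA.birkhoff f.mapsTo p).eq_of_eq_id hper hz (circ_subset_disk hx)
  have hAj (j : ℕ) : IntegrableOn (fun z => A (f.toFun^[j] z)) Disk :=
    (hA.continuousOn.comp (f.continuousOn_iterate j) (f.mapsTo.iterate j)).integrableOn_compact
      (isCompact_closedBall 0 1)
  have hvol : volume.real Disk = π := by
    simp [Measure.real, Disk, Complex.volume_closedBall]
  have hSp : ∀ z ∈ Disk, birkhoffSum f.toFun A p z = p * c := by
    have h1 : ∫ z in Disk, birkhoffSum f.toFun A p z = p * ∫ z in Disk, A z := by
      simp only [birkhoffSum]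
      rw [integral_finsetSum _ fun j _ => hAj j]
      simp [f.integral_iterate]
    have h2 : ∫ z in Disk, birkhoffSum f.toFun A p z = π * birkhoffSum f.toFun A p x := by
      rw [setIntegral_congr_fun (s := Disk) measurableSet_closedBall hconst]
      simp [hvol]
    intro z hz
    rw [hconst z hz, hc]
    have := Real.pi_ne_zero
    field_simp
    linarith
  have hsum : ∑ i ∈ Finset.range p, (birkhoffSum f.toFun A n (f.toFun^[i] x) - n * c) = 0 := by
    rw [Finset.sum_sub_distrib]
    simp only [birkhoffSum]
    rw [Finset.sum_comm]
    have : ∀ j ∈ Finset.range n, ∑ i ∈ Finset.range p, A (f.toFun^[j] (f.toFun^[i] x)) = p * c := by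
      intro j _
      rw [← hSp _ (f.mapsTo.iterate j (circ_subset_disk hx))]
      refine Finset.sum_congr rfl fun i _ => ?_
      rw [← Function.iterate_add_apply, ← Function.iterate_add_apply, add_comm]
    rw [Finset.sum_congr rfl this]
    simp
    ring
  have hdev : (p : ℝ) * (birkhoffSum f.toFun A n x - n * c) = ∑ i ∈ Finset.range p,
      (birkhoffSum f.toFun A n x - birkhoffSum f.toFun A n (f.toFun^[i] x)) := by
    rw [← add_zero (∑ i ∈ Finset.range p, _), ← hsum, ← Finset.sum_add_distrib]
    simp [mul_sub]
  have hle : |(p : ℝ) * (birkhoffSum f.toFun A n x - n * c)| ≤ p * 2 := by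
    rw [hdev]
    refine (Finset.abs_sum_le_sum_abs _ _).trans ?_
    refine (Finset.sum_le_card_nsmul _ _ 2 fun i _ =>
      f.abs_birkhoffSum_sub_le hA n hx (f.mapsTo_circ.iterate i hx)).trans ?_
    simp
  rw [abs_mul, abs_of_pos hp0] at hle
  exact le_of_mul_le_mul_left hle hp0

end SympDiff

/-- The planar cross product. -/
def crossProd (z w : ℂ) : ℝ := z.re * w.im - z.im * w.re

lemma abs_crossProd_le (z w : ℂ) : |crossProd z w| ≤ ‖z‖ * ‖w‖ := by
  have h : crossProd z w = (starRingEnd ℂ z * w).im := by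
    simp [crossProd, sub_eq_add_neg]
  rw [h]
  exact (Complex.abs_im_le_norm _).trans (by simp)

lemma crossProd_map (L : ℂ →ₗ[ℝ] ℂ) (z w : ℂ) :
    crossProd (L z) (L w) = LinearMap.det L * crossProd z w := by
  have hL (u : ℂ) : L u = u.re • L 1 + u.im • L Complex.I := by
    rw [← map_smul, ← map_smul, ← map_add]
    congr 1
    apply Complex.ext <;> simp
  rw [← LinearMap.det_toMatrix Complex.basisOneI, Matrix.det_fin_two, hL z, hL w]
  simp [crossProd, LinearMap.toMatrix_apply]
  ring

lemma ContinuousOn.crossProd {X : Type*} [TopologicalSpace X] {s : Set X} {u v : X → ℂ}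
    (hu : ContinuousOn u s) (hv : ContinuousOn v s) :
    ContinuousOn (fun t => crossProd (u t) (v t)) s :=
  ((Complex.continuous_re.comp_continuousOn hu).mul
    (Complex.continuous_im.comp_continuousOn hv)).sub
    ((Complex.continuous_im.comp_continuousOn hu).mul (Complex.continuous_re.comp_continuousOn hv))

lemma HasDerivAt.crossProd {u v : ℝ → ℂ} {u' v' : ℂ} {t : ℝ} (hu : HasDerivAt u u' t)
    (hv : HasDerivAt v v' t) :
    HasDerivAt (fun t => crossProd (u t) (v t))
      (_root_.crossProd u' (v t) + _root_.crossProd (u t) v') t := by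
  have hur := Complex.reCLM.hasFDerivAt.comp_hasDerivAt t hu
  have hui := Complex.imCLM.hasFDerivAt.comp_hasDerivAt t hu
  have hvr := Complex.reCLM.hasFDerivAt.comp_hasDerivAt t hv
  have hvi := Complex.imCLM.hasFDerivAt.comp_hasDerivAt t hv
  refine ((hur.mul hvi).sub (hui.mul hvr)).congr_deriv ?_
  simp only [Complex.reCLM_apply, Complex.imCLM_apply, Function.comp, _root_.crossProd]
  ring

lemma smul_mem_disk {z : ℂ} (hz : z ∈ Disk) {t : ℝ} (ht : t ∈ Icc (0 : ℝ) 1) : t • z ∈ Disk := by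
  simp only [Disk, mem_closedBall, dist_zero_right, norm_smul, Real.norm_eq_abs] at *
  rw [abs_of_nonneg ht.1]
  nlinarith [norm_nonneg z, ht.1, ht.2]

namespace SympDiff

variable (f : SympDiff)

/-- The primitive of `f*λ - λ` obtained by integrating along rays from the origin. -/
def rayPrimitive (z : ℂ) : ℝ :=
  (2 * π)⁻¹ * ∫ t in (0 : ℝ)..1,
    crossProd (f.toFun (t • z)) (fderivWithin ℝ f.toFun Disk (t • z) z)

lemma continuousOn_fderivWithin : ContinuousOn (fderivWithin ℝ f.toFun Disk) Disk :=
  f.contDiffOn.continuousOn_fderivWithin uniqueDiffOn_disk le_rfl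

lemma continuousOn_ray {z : ℂ} (hz : z ∈ Disk) :
    ContinuousOn (fun t : ℝ => f.toFun (t • z)) (Icc 0 1) :=
  f.contDiffOn.continuousOn.comp (by fun_prop) fun _ ht => smul_mem_disk hz ht

lemma continuousOn_fderivWithin_ray {z : ℂ} (hz : z ∈ Disk) (w : ℂ) :
    ContinuousOn (fun t : ℝ => fderivWithin ℝ f.toFun Disk (t • z) w) (Icc 0 1) :=
  (f.continuousOn_fderivWithin.comp (by fun_prop) fun _ ht => smul_mem_disk hz ht).clm_apply
    continuousOn_const

lemma hasDerivAt_ray {z : ℂ} (hz : z ∈ Disk) {t : ℝ} (ht : t ∈ Ioo (0 : ℝ) 1) :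
    HasDerivAt (fun t : ℝ => f.toFun (t • z)) (fderivWithin ℝ f.toFun Disk (t • z) z) t := by
  have h1 : HasDerivAt (fun t : ℝ => t • z) z t := by
    simpa using (hasDerivAt_id t).smul_const z
  refine (f.hasFDerivWithinAt (smul_mem_disk hz ⟨ht.1.le, ht.2.le⟩)).comp_hasDerivAt t h1 ?_
  filter_upwards [Ioo_mem_nhds ht.1 ht.2] with s hs
  exact smul_mem_disk hz ⟨hs.1.le, hs.2.le⟩

/-- An exact formula for the increments of the primitive, with all error terms explicit. -/
lemma rayPrimitive_sub {z z' : ℂ} (hz : z ∈ Disk) (hz' : z' ∈ Disk) :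
    2 * π * (f.rayPrimitive z' - f.rayPrimitive z) -
        (crossProd (f.toFun z) (fderivWithin ℝ f.toFun Disk z (z' - z)) - crossProd z (z' - z)) =
      (∫ t in (0 : ℝ)..1,
        (2 * crossProd (f.toFun (t • z') - f.toFun (t • z) -
            fderivWithin ℝ f.toFun Disk (t • z) (t • z' - t • z))
            (fderivWithin ℝ f.toFun Disk (t • z) z) +
          crossProd (f.toFun (t • z') - f.toFun (t • z))
            (fderivWithin ℝ f.toFun Disk (t • z') z' - fderivWithin ℝ f.toFun Disk (t • z) z))) +
      crossProd (f.toFun z)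
        (f.toFun z' - f.toFun z - fderivWithin ℝ f.toFun Disk z (z' - z)) := by
  have hpi := Real.pi_ne_zero
  have hH := f.continuousOn_ray hz
  have hG := f.continuousOn_ray hz'
  have hH' := f.continuousOn_fderivWithin_ray hz z
  have hG' := f.continuousOn_fderivWithin_ray hz' z'
  have hDh := f.continuousOn_fderivWithin_ray hz (z' - z)
  have hray {u : ℂ} (hu : u ∈ Disk) {t : ℝ} (ht : t ∈ Ioo (0 : ℝ) 1) := f.hasDerivAt_ray hu ht
  have hrp (u : ℂ) : 2 * π * f.rayPrimitive u = ∫ t in (0 : ℝ)..1,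
      crossProd (f.toFun (t • u)) (fderivWithin ℝ f.toFun Disk (t • u) u) := by
    rw [rayPrimitive]
    field_simp
  have hid : ContinuousOn (fun t : ℝ => t) (Icc 0 1) := continuousOn_id
  set D := fderivWithin ℝ f.toFun Disk
  have hΔ : ContinuousOn (fun t : ℝ => f.toFun (t • z') - f.toFun (t • z)) (Icc 0 1) := hG.sub hH
  have hΔ' : ContinuousOn (fun t : ℝ => D (t • z') z' - D (t • z) z) (Icc 0 1) := hG'.sub hH'
  have hint {u v : ℝ → ℂ} (hu : ContinuousOn u (Icc 0 1)) (hv : ContinuousOn v (Icc 0 1)) :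
      IntervalIntegrable (fun t => crossProd (u t) (v t)) volume 0 1 :=
    ContinuousOn.intervalIntegrable (by rw [uIcc_of_le zero_le_one]; exact hu.crossProd hv)
  have hparts : ∫ t in (0 : ℝ)..1, (crossProd (D (t • z) z) (f.toFun (t • z') - f.toFun (t • z)) +
      crossProd (f.toFun (t • z)) (D (t • z') z' - D (t • z) z)) =
      crossProd (f.toFun z) (f.toFun z' - f.toFun z) := by
    rw [intervalIntegral.integral_eq_sub_of_hasDerivAt_of_le zero_le_one
      (hH.crossProd hΔ)
      (fun t ht => (hray hz ht).crossProd ((hray hz' ht).fun_sub (hray hz ht)))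
      ((hint hH' hΔ).add (hint hH hΔ'))]
    simp [crossProd]
  have hdet : ∀ t ∈ Icc (0 : ℝ) 1, crossProd (D (t • z) (z' - z)) (D (t • z) z) =
      crossProd (z' - z) z := by
    intro t ht
    have h1 := crossProd_map (D (t • z)).toLinearMap (z' - z) z
    rw [f.jacobian _ (smul_mem_disk hz ht), one_mul] at h1
    exact h1
  have harea : ∫ t in (0 : ℝ)..1, t * (2 * crossProd (D (t • z) (z' - z)) (D (t • z) z)) =
      crossProd (z' - z) z := by
    rw [intervalIntegral.integral_congr (g := fun t => t * (2 * crossProd (z' - z) z))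
      (fun t ht => by
        rw [uIcc_of_le zero_le_one] at ht
        simp only [hdet t ht]),
      intervalIntegral.integral_mul_const, integral_id]
    ring
  have hcr : crossProd (z' - z) z = - crossProd z (z' - z) := by
    simp only [crossProd, Complex.sub_re, Complex.sub_im]; ring
  have hlhs : 2 * π * (f.rayPrimitive z' - f.rayPrimitive z) =
      (∫ t in (0 : ℝ)..1, crossProd (f.toFun (t • z')) (D (t • z') z')) -
        ∫ t in (0 : ℝ)..1, crossProd (f.toFun (t • z)) (D (t • z) z) := by
    rw [mul_sub, hrp, hrp]
  have hlast : crossProd (f.toFun z) (f.toFun z' - f.toFun z - D z (z' - z)) =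
      crossProd (f.toFun z) (f.toFun z' - f.toFun z) - crossProd (f.toFun z) (D z (z' - z)) := by
    simp only [crossProd, Complex.sub_re, Complex.sub_im]; ring
  have hareaInt : IntervalIntegrable
      (fun t : ℝ => t * (2 * crossProd (D (t • z) (z' - z)) (D (t • z) z))) volume 0 1 :=
    ContinuousOn.intervalIntegrable (by
      rw [uIcc_of_le zero_le_one]
      exact hid.mul (continuousOn_const.mul (hDh.crossProd hH')))
  have hmain : ∫ t in (0 : ℝ)..1,
        (2 * crossProd (f.toFun (t • z') - f.toFun (t • z) - D (t • z) (t • z' - t • z))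
            (D (t • z) z) +
          crossProd (f.toFun (t • z') - f.toFun (t • z)) (D (t • z') z' - D (t • z) z)) =
      (∫ t in (0 : ℝ)..1, crossProd (f.toFun (t • z')) (D (t • z') z')) -
        (∫ t in (0 : ℝ)..1, crossProd (f.toFun (t • z)) (D (t • z) z)) -
        (∫ t in (0 : ℝ)..1, (crossProd (D (t • z) z) (f.toFun (t • z') - f.toFun (t • z)) +
          crossProd (f.toFun (t • z)) (D (t • z') z' - D (t • z) z))) -
        ∫ t in (0 : ℝ)..1, t * (2 * crossProd (D (t • z) (z' - z)) (D (t • z) z)) := by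
    rw [← intervalIntegral.integral_sub (hint hG hG') (hint hH hH'),
      ← intervalIntegral.integral_sub ((hint hG hG').sub (hint hH hH'))
        ((hint hH' hΔ).add (hint hH hΔ')),
      ← intervalIntegral.integral_sub (((hint hG hG').sub (hint hH hH')).sub
        ((hint hH' hΔ).add (hint hH hΔ'))) hareaInt]
    refine intervalIntegral.integral_congr fun t _ => ?_
    simp only [← smul_sub, map_smul]
    simp only [crossProd, Complex.sub_re, Complex.sub_im, Complex.smul_re, Complex.smul_im,
      smul_eq_mul]
    ring
  rw [hmain, hparts, harea, hlhs, hlast, hcr]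
  ring

lemma exists_fderivWithin_bound :
    ∃ M : ℝ, 0 ≤ M ∧ ∀ z ∈ Disk, ‖fderivWithin ℝ f.toFun Disk z‖ ≤ M := by
  obtain ⟨M, hM⟩ := (isCompact_closedBall (0 : ℂ) 1).exists_bound_of_continuousOn
    f.continuousOn_fderivWithin
  exact ⟨M, (norm_nonneg _).trans (hM 0 (by simp)), hM⟩

/-- Uniform first order expansion on the disk. -/
lemma exists_uniform_expansion {ε : ℝ} (hε : 0 < ε) : ∃ δ > 0, ∀ x ∈ Disk, ∀ y ∈ Disk,
    ‖y - x‖ < δ →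
      ‖fderivWithin ℝ f.toFun Disk y - fderivWithin ℝ f.toFun Disk x‖ ≤ ε ∧
      ‖f.toFun y - f.toFun x - fderivWithin ℝ f.toFun Disk x (y - x)‖ ≤ ε * ‖y - x‖ := by
  have hu := (isCompact_closedBall (0 : ℂ) 1).uniformContinuousOn_of_continuous
    f.continuousOn_fderivWithin
  obtain ⟨δ, hδ, h⟩ := Metric.uniformContinuousOn_iff.1 hu ε hε
  have hclose : ∀ x ∈ Disk, ∀ y ∈ Disk, ‖y - x‖ < δ →
      ‖fderivWithin ℝ f.toFun Disk y - fderivWithin ℝ f.toFun Disk x‖ ≤ ε := fun x hx y hy hxy => by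
    have := h y hy x hx (by rwa [dist_eq_norm])
    rw [dist_eq_norm] at this
    exact this.le
  refine ⟨δ, hδ, fun x hx y hy hxy => ⟨hclose x hx y hy hxy, ?_⟩⟩
  exact Convex.norm_image_sub_le_of_norm_hasFDerivWithin_le' (s := Disk ∩ ball x δ)
    (fun u hu => (f.hasFDerivWithinAt hu.1).mono inter_subset_left)
    (fun u hu => hclose x hx u hu.1 (by simpa [dist_eq_norm] using hu.2))
    ((convex_closedBall 0 1).inter (convex_ball x δ)) ⟨hx, mem_ball_self hδ⟩
    ⟨hy, by simpa [dist_eq_norm] using hxy⟩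

lemma isPrimitive_rayPrimitive : IsPrimitive f.toFun f.rayPrimitive := by
  intro z hz
  refine ⟨_, f.hasFDerivWithinAt hz, ?_⟩
  obtain ⟨M, hM0, hM⟩ := f.exists_fderivWithin_bound
  rw [hasFDerivWithinAt_iff_isLittleO, Asymptotics.isLittleO_iff]
  intro c hc
  set K := 2 * M + M * (1 + M) + 1 with hK
  have hKpos : 0 < K := by positivity
  obtain ⟨δ, hδ, h⟩ := f.exists_uniform_expansion (show 0 < c / K by positivity)
  set ε := c / K with hε
  have hεpos : 0 < ε := by positivity
  filter_upwards [self_mem_nhdsWithin,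
    mem_nhdsWithin_of_mem_nhds (ball_mem_nhds z (lt_min hδ hεpos))] with z' hz' hball
  have hh : ‖z' - z‖ < min δ ε := by simpa [dist_eq_norm] using hball
  have hhδ := hh.trans_le (min_le_left _ _)
  have hhε := hh.trans_le (min_le_right _ _)
  set r := ‖z' - z‖ with hr
  have hr0 : 0 ≤ r := norm_nonneg _
  have hnorm : ∀ u ∈ Disk, ‖u‖ ≤ 1 := fun u hu => by simpa [Disk] using hu
  set D := fderivWithin ℝ f.toFun Disk with hD
  have hDle : ∀ u ∈ Disk, ∀ w, ‖D u w‖ ≤ M * ‖w‖ := fun u hu w =>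
    (D u).le_of_opNorm_le (hM u hu) w
  have hlip : ∀ u ∈ Disk, ∀ v ∈ Disk, ‖f.toFun v - f.toFun u‖ ≤ M * ‖v - u‖ := fun u hu v hv =>
    (convex_closedBall (0 : ℂ) 1).norm_image_sub_le_of_norm_hasFDerivWithin_le
      (fun x hx => f.hasFDerivWithinAt hx) hM hu hv
  have key := f.rayPrimitive_sub hz hz'
  have hI := intervalIntegral.norm_integral_le_of_norm_le_const (a := 0) (b := 1)
    (C := 2 * (ε * r * M) + M * r * (ε * (1 + M)))
    (f := fun t : ℝ => 2 * crossProd (f.toFun (t • z') - f.toFun (t • z) -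
            D (t • z) (t • z' - t • z)) (D (t • z) z) +
          crossProd (f.toFun (t • z') - f.toFun (t • z)) (D (t • z') z' - D (t • z) z)) (by
    intro t ht
    rw [uIoc_of_le zero_le_one] at ht
    have ht' : t ∈ Icc (0 : ℝ) 1 := ⟨ht.1.le, ht.2⟩
    have hu := smul_mem_disk hz ht'
    have hv := smul_mem_disk hz' ht'
    have htr : ‖t • z' - t • z‖ ≤ r := by
      rw [← smul_sub, norm_smul, Real.norm_eq_abs, abs_of_pos ht.1]
      nlinarith [ht.2]
    have hexp := h _ hu _ hv (htr.trans_lt hhδ)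
    have b1 : ‖D (t • z) z‖ ≤ M :=
      (hDle _ hu z).trans (mul_le_of_le_one_right hM0 (hnorm z hz))
    have b2 : ‖f.toFun (t • z') - f.toFun (t • z) - D (t • z) (t • z' - t • z)‖ ≤ ε * r :=
      hexp.2.trans (by gcongr)
    have b3 : ‖f.toFun (t • z') - f.toFun (t • z)‖ ≤ M * r :=
      (hlip _ hu _ hv).trans (by gcongr)
    have b4 : ‖D (t • z') z' - D (t • z) z‖ ≤ ε * (1 + M) := by
      have e : D (t • z') z' - D (t • z) z = (D (t • z') - D (t • z)) z' + D (t • z) (z' - z) := by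
        simp
      rw [e]
      refine (norm_add_le _ _).trans ?_
      have c1 : ‖(D (t • z') - D (t • z)) z'‖ ≤ ε * 1 :=
        ((D (t • z') - D (t • z)).le_of_opNorm_le hexp.1 z').trans (by gcongr; exact hnorm z' hz')
      have c2 : ‖D (t • z) (z' - z)‖ ≤ M * ε := (hDle _ hu _).trans (by gcongr)
      linarith
    rw [Real.norm_eq_abs]
    refine (abs_add_le _ _).trans (add_le_add ?_ ?_)
    · rw [abs_mul, abs_two]
      gcongr
      exact (abs_crossProd_le _ _).trans (by gcongr)
    · exact (abs_crossProd_le _ _).trans (by gcongr))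
  have hlast : |crossProd (f.toFun z) (f.toFun z' - f.toFun z - D z (z' - z))| ≤ 1 * (ε * r) :=
    (abs_crossProd_le _ _).trans (by
      gcongr
      · exact hnorm _ (f.mapsTo hz)
      · exact (h z hz z' hz' hhδ).2)
  have hpi := Real.pi_gt_three
  have hlam : ∀ u w : ℂ, crossProd u w = 2 * π * lform u w := fun u w => by
    rw [lform, crossProd]; field_simp
  rw [hlam, hlam, ← mul_sub, ← mul_sub] at key
  have hfinal : 2 * π * ‖f.rayPrimitive z' - f.rayPrimitive z -
      ((liouvilleCLM (f.toFun z)).comp (D z) - liouvilleCLM z) (z' - z)‖ ≤ ε * K * r := by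
    rw [_root_.sub_apply, ContinuousLinearMap.comp_apply, liouvilleCLM_apply, liouvilleCLM_apply,
      Real.norm_eq_abs]
    nth_rewrite 1 [← abs_of_pos (show 0 < 2 * π by positivity)]
    rw [← abs_mul, key]
    refine (abs_add_le _ _).trans ?_
    rw [Real.norm_eq_abs] at hI
    refine (add_le_add hI hlast).trans (le_of_eq ?_)
    rw [hK]
    simp
    ring
  have hεK : ε * K = c := div_mul_cancel₀ c hKpos.ne'
  rw [hεK] at hfinal
  refine le_trans ?_ hfinal
  exact le_mul_of_one_le_left (norm_nonneg _) (by linarith)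

end SympDiff

namespace SympDiff

variable (f g : SympDiff)

lemma norm_sub_le_d1 {z : ℂ} (hz : z ∈ Disk) :
    ‖g.toFun z - f.toFun z‖ ≤ d1 g.toFun g.invFun f.toFun f.invFun ∧
      ‖fderivWithin ℝ g.toFun Disk z - fderivWithin ℝ f.toFun Disk z‖ ≤
        d1 g.toFun g.invFun f.toFun f.invFun := by
  have hbdd {E : Type} [NormedAddCommGroup E] (u : ℂ → E) (hu : ContinuousOn u Disk) :
      BddAbove (range fun z : Disk => ‖u z‖) := by
    obtain ⟨C, hC⟩ := (isCompact_closedBall (0 : ℂ) 1).exists_bound_of_continuousOn hu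
    exact ⟨C, by rintro _ ⟨w, rfl⟩; exact hC w w.2⟩
  have h1 := le_ciSup (hbdd (fun z => g.toFun z - f.toFun z)
    (g.contDiffOn.continuousOn.sub f.contDiffOn.continuousOn)) ⟨z, hz⟩
  have h2 := le_ciSup (hbdd
    (fun z => fderivWithin ℝ g.toFun Disk z - fderivWithin ℝ f.toFun Disk z)
    (g.continuousOn_fderivWithin.sub f.continuousOn_fderivWithin)) ⟨z, hz⟩
  exact ⟨h1.trans ((le_max_left _ _).trans (le_max_left _ _)),
    h2.trans ((le_max_left _ _).trans (le_max_right _ _))⟩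

lemma abs_rayPrimitive_sub_le {M : ℝ}
    (hM : ∀ z ∈ Disk, ‖fderivWithin ℝ f.toFun Disk z‖ ≤ M) {z : ℂ} (hz : z ∈ Disk) :
    |g.rayPrimitive z - f.rayPrimitive z| ≤
      d1 g.toFun g.invFun f.toFun f.invFun * (M + 1) := by
  set d := d1 g.toFun g.invFun f.toFun f.invFun with hd
  have hd0 : 0 ≤ d := (norm_nonneg _).trans (f.norm_sub_le_d1 g hz).1
  have hM0 : 0 ≤ M := (norm_nonneg _).trans (hM z hz)
  have hz1 : ‖z‖ ≤ 1 := by simpa [Disk] using hz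
  have hint (h : SympDiff) : IntervalIntegrable (fun t : ℝ =>
      crossProd (h.toFun (t • z)) (fderivWithin ℝ h.toFun Disk (t • z) z)) volume 0 1 :=
    ContinuousOn.intervalIntegrable (by
      rw [uIcc_of_le zero_le_one]
      exact (h.continuousOn_ray hz).crossProd (h.continuousOn_fderivWithin_ray hz z))
  rw [rayPrimitive, rayPrimitive, ← mul_sub, ← intervalIntegral.integral_sub (hint g) (hint f),
    abs_mul]
  have hI := intervalIntegral.norm_integral_le_of_norm_le_const (a := 0) (b := 1)
    (C := d * (M + 1))
    (f := fun t : ℝ => crossProd (g.toFun (t • z)) (fderivWithin ℝ g.toFun Disk (t • z) z) -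
      crossProd (f.toFun (t • z)) (fderivWithin ℝ f.toFun Disk (t • z) z)) (by
    intro t ht
    rw [uIoc_of_le zero_le_one] at ht
    have hu := smul_mem_disk hz ⟨ht.1.le, ht.2⟩
    obtain ⟨h0, h1⟩ := f.norm_sub_le_d1 g hu
    have e : crossProd (g.toFun (t • z)) (fderivWithin ℝ g.toFun Disk (t • z) z) -
        crossProd (f.toFun (t • z)) (fderivWithin ℝ f.toFun Disk (t • z) z) =
        crossProd (g.toFun (t • z) - f.toFun (t • z)) (fderivWithin ℝ f.toFun Disk (t • z) z) +
        crossProd (g.toFun (t • z)) ((fderivWithin ℝ g.toFun Disk (t • z) -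
          fderivWithin ℝ f.toFun Disk (t • z)) z) := by
      simp only [crossProd, Complex.sub_re, Complex.sub_im, _root_.sub_apply]
      ring
    have hg1 : ‖g.toFun (t • z)‖ ≤ 1 := by simpa [Disk] using g.mapsTo hu
    have b1 := (fderivWithin ℝ f.toFun Disk (t • z)).le_of_opNorm_le_of_le (hM _ hu) hz1
    have b2 := (fderivWithin ℝ g.toFun Disk (t • z) -
          fderivWithin ℝ f.toFun Disk (t • z)).le_of_opNorm_le_of_le h1 hz1
    rw [e, Real.norm_eq_abs]
    calc _ ≤ d * (M * 1) + 1 * (d * 1) := by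
          refine (abs_add_le _ _).trans (add_le_add ?_ ?_)
          · exact (abs_crossProd_le _ _).trans (by gcongr)
          · exact (abs_crossProd_le _ _).trans (by gcongr)
      _ = d * (M + 1) := by ring)
  rw [Real.norm_eq_abs] at hI
  have hpi : |(2 * π)⁻¹| ≤ 1 := by
    rw [abs_of_pos (by positivity)]
    exact inv_le_one_of_one_le₀ (by linarith [Real.pi_gt_three])
  calc _ ≤ 1 * (d * (M + 1) * |1 - 0|) := by gcongr
    _ = d * (M + 1) := by simp

end SympDiff

lemma IsPrimitive.add_const {F : ℂ → ℂ} {A : ℂ → ℝ} (hA : IsPrimitive F A) (c : ℝ) :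
    IsPrimitive F (fun z => A z + c) := fun z hz => by
  obtain ⟨F', hF', hA'⟩ := hA z hz
  exact ⟨F', hF', hA'.add_const c⟩

lemma tendsto_iterate {f : SympDiff} {g : ℕ → SympDiff}
    (hconv : Tendsto (fun k => d1 (g k).toFun (g k).invFun f.toFun f.invFun) atTop (𝓝 0))
    {x : ℂ} (hx : x ∈ Disk) (j : ℕ) :
    Tendsto (fun k => (g k).toFun^[j] x) atTop (𝓝 (f.toFun^[j] x)) := by
  induction j with
  | zero => exact tendsto_const_nhds
  | succ j ih =>
    have hfj : f.toFun^[j] x ∈ Disk := f.mapsTo.iterate j hx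
    have hgj (k : ℕ) : (g k).toFun^[j] x ∈ Disk := (g k).mapsTo.iterate j hx
    have h1 : Tendsto (fun k => f.toFun ((g k).toFun^[j] x)) atTop (𝓝 (f.toFun (f.toFun^[j] x))) :=
      (f.contDiffOn.continuousOn _ hfj).tendsto.comp
        (tendsto_nhdsWithin_iff.2 ⟨ih, Eventually.of_forall hgj⟩)
    have h2 : Tendsto (fun k => (g k).toFun ((g k).toFun^[j] x) - f.toFun ((g k).toFun^[j] x))
        atTop (𝓝 0) :=
      squeeze_zero_norm (fun k => (f.norm_sub_le_d1 (g k) (hgj k)).1) hconv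
    simpa [Function.iterate_succ_apply'] using h2.add h1

/-- If `f` is a `C¹`-limit of finite order elements of `Diff¹_ω(D)`,
then `Cal₁(f) = 0`. -/
theorem cal_limit_of_finite_order (f : SympDiff) (g : ℕ → SympDiff) (p : ℕ → ℕ)
    (hp : ∀ k, 1 ≤ p k)
    (hper : ∀ k, ∀ z ∈ Disk, (g k).toFun^[p k] z = z)
    (hconv : Filter.Tendsto
      (fun k => d1 (g k).toFun (g k).invFun f.toFun f.invFun) Filter.atTop (nhds 0))
    (A : ℂ → ℝ) (hA : IsNormalizedAction f A) :
    (1 / Real.pi) * ∫ z in Disk, A z = 0 := by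
  have hP := f.isPrimitive_of_isAction hA.1
  obtain ⟨M, -, hM⟩ := f.exists_fderivWithin_bound
  have h0 : (0 : ℂ) ∈ Disk := by simp [Disk]
  have h1 : (1 : ℂ) ∈ Circ := by simp [Circ]
  have h1D := circ_subset_disk h1
  set a := A 0 - f.rayPrimitive 0 with ha
  set B : ℕ → ℂ → ℝ := fun k z => (g k).rayPrimitive z + a with hB
  have hBP (k : ℕ) : IsPrimitive (g k).toFun (B k) := (g k).isPrimitive_rayPrimitive.add_const a
  set ε : ℕ → ℝ := fun k => d1 (g k).toFun (g k).invFun f.toFun f.invFun * (M + 1)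
  have hε : Tendsto ε atTop (𝓝 0) := by simpa using hconv.mul_const (M + 1)
  have hBA (k : ℕ) : ∀ z ∈ Disk, |B k z - A z| ≤ ε k := fun z hz => by
    have := hP.sub_eq_sub f.isPrimitive_rayPrimitive hz h0
    have e : B k z - A z = (g k).rayPrimitive z - f.rayPrimitive z := by
      simp only [hB, ha]; linarith
    rw [e]
    exact f.abs_rayPrimitive_sub_le (g k) hM hz
  have hint {h : ℂ → ℝ} (hc : ContinuousOn h Disk) : IntegrableOn h Disk :=
    hc.integrableOn_compact (isCompact_closedBall 0 1)
  have hlim : Tendsto (fun k => ∫ z in Disk, B k z) atTop (𝓝 (∫ z in Disk, A z)) := by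
    rw [tendsto_iff_norm_sub_tendsto_zero]
    refine squeeze_zero (fun _ => norm_nonneg _) (fun k => ?_)
      (by simpa using hε.mul_const (volume.real Disk))
    rw [← integral_sub (hint (hBP k).continuousOn) (hint hP.continuousOn)]
    exact norm_setIntegral_le_of_norm_le_const measure_closedBall_lt_top (hBA k)
  have hmean := hlim.const_mul (1 / π)
  set c := 1 / π * ∫ z in Disk, A z
  have hS (n : ℕ) : Tendsto (fun k => birkhoffSum (g k).toFun (B k) n 1) atTop
      (𝓝 (birkhoffSum f.toFun A n 1)) := by
    refine tendsto_finsetSum _ fun j _ => ?_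
    have hgj (k : ℕ) : (g k).toFun^[j] 1 ∈ Disk := (g k).mapsTo.iterate j h1D
    have e1 : Tendsto (fun k => A ((g k).toFun^[j] 1)) atTop (𝓝 (A (f.toFun^[j] 1))) :=
      (hP.continuousOn _ (f.mapsTo.iterate j h1D)).tendsto.comp
        (tendsto_nhdsWithin_iff.2 ⟨tendsto_iterate hconv h1D j, Eventually.of_forall hgj⟩)
    have e2 : Tendsto (fun k => B k ((g k).toFun^[j] 1) - A ((g k).toFun^[j] 1)) atTop (𝓝 0) :=
      squeeze_zero_norm (fun k => hBA k _ (hgj k)) hε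
    simpa using e2.add e1
  have hbound (n : ℕ) : n * |c| ≤ 4 := by
    have e1 : |birkhoffSum f.toFun A n 1 - n * c| ≤ 2 :=
      le_of_tendsto ((hS n).sub (hmean.const_mul (n : ℝ))).abs (Eventually.of_forall fun k =>
        (g k).abs_birkhoffSum_sub_mean_le (hBP k) (hp k) (hper k) n h1)
    have e2 := f.abs_birkhoffSum_le_of_isNormalizedAction hA n h1
    rw [← Nat.abs_cast n, ← abs_mul]
    rw [abs_le] at *
    constructor <;> linarith [e1.1, e1.2, e2.1, e2.2]
  by_contra hc
  obtain ⟨n, hn⟩ := exists_nat_gt (4 / |c|)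
  rw [div_lt_iff₀ (abs_pos.2 hc)] at hn
  linarith [hbound n]
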